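/- The equilibrium 𝟙 of system (1.1) is unstable, with initial data arbitrarily close to it leading to both possible regimes: for every δ > 0 there exist v, w ∈ ℝ^d with |v − 𝟙| < δ and |w − 𝟙| < δ such that the maximal solution U^v blows up in finite time, while the maximal solution U^w is global and U^w(t) → 0 as t → ∞. -/

import Mathlib

open scoped BigOperators
open Filter Topology Set

/-- The `n`-th coordinate (0-based) of a vector in `ℝ^d`, with junk value `0` out of range. -/
noncomputable def coordFn {d : ℕ} (u : Fin d → ℝ) (n : ℕ) : ℝ :=
  if hn : n < d then u ⟨n, hn⟩ else 0

/-- The vector field `b` of system (1.1) (0-based indices: coordinate `1 ≤ k ≤ d` of the paper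
is coordinate `k - 1` here). -/
noncomputable def bField (d : ℕ) (h p : ℝ) (u : Fin d → ℝ) (i : Fin d) : ℝ :=
  if (i : ℕ) = 0 then (2 / h ^ 2) * (-coordFn u 0 + coordFn u 1)
  else if (i : ℕ) = d - 1 then
    (2 / h ^ 2) * (-coordFn u (d - 1) + coordFn u (d - 2)
      + h * ((max (coordFn u (d - 1)) 0) ^ p - coordFn u (d - 1)))
  else (1 / h ^ 2) * (coordFn u ((i : ℕ) + 1) - 2 * coordFn u (i : ℕ) + coordFn u ((i : ℕ) - 1))

/-- The Euclidean norm on `ℝ^d`. -/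
noncomputable def euclNorm {d : ℕ} (u : Fin d → ℝ) : ℝ := Real.sqrt (∑ i, (u i) ^ 2)

/-- `u` belongs to the domain of explosion `D_e`: the (unique, maximal) solution of (1.1)
starting at `u` blows up in finite time, i.e. there are `τ < ∞` and a solution `U` of (1.1)
on `[0, τ)` with `U(0) = u` and `|U(t)| → ∞` as `t → τ⁻`. -/
def BlowsUp (d : ℕ) (h p : ℝ) (u : Fin d → ℝ) : Prop :=
  ∃ (τ : ℝ) (U : ℝ → Fin d → ℝ), 0 < τ ∧ U 0 = u ∧
    (∀ t ∈ Set.Ico 0 τ, HasDerivWithinAt U (bField d h p (U t)) (Set.Ico 0 τ) t) ∧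
    Filter.Tendsto (fun t => euclNorm (U t)) (nhdsWithin τ (Set.Iio τ)) Filter.atTop

/-- The (unique, maximal) solution of (1.1) starting at `u` is global and converges to `L`
as `t → ∞`. -/
def GlobalTo (d : ℕ) (h p : ℝ) (u L : Fin d → ℝ) : Prop :=
  ∃ U : ℝ → Fin d → ℝ, U 0 = u ∧
    (∀ t : ℝ, 0 ≤ t → HasDerivWithinAt U (bField d h p (U t)) (Set.Ici 0) t) ∧
    Filter.Tendsto U Filter.atTop (nhds L)

/-! ### Locally Lipschitz maps and global solutions of bounded fields -/

lemma locallyLipschitz_pi_of_apply {ι α : Type*} [Fintype ι] [PseudoEMetricSpace α]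
    {f : α → ι → ℝ} (hf : ∀ i, LocallyLipschitz fun x => f x i) : LocallyLipschitz f := by
  intro x
  choose K t ht hK using fun i => hf i x
  refine ⟨Finset.univ.sup K, ⋂ i, t i, Filter.iInter_mem.2 ht, fun y hy z hz => ?_⟩
  rw [edist_pi_le_iff]
  intro i
  refine (hK i (mem_iInter.1 hy i) (mem_iInter.1 hz i)).trans ?_
  gcongr
  exact Finset.le_sup (Finset.mem_univ i)

lemma eqOn_Ioo_of_hasDerivWithinAt_Icc {E : Type*} [NormedAddCommGroup E] [NormedSpace ℝ E]
    {F : E → E} (hF : LocallyLipschitz F) {f g : ℝ → E} {a : ℝ}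
    (hf : ∀ t ∈ Icc (-a) a, HasDerivWithinAt f (F (f t)) (Icc (-a) a) t)
    (hg : ∀ t ∈ Icc (-a) a, HasDerivWithinAt g (F (g t)) (Icc (-a) a) t)
    (h0 : f 0 = g 0) : EqOn f g (Ioo (-a) a) := by
  intro t ht
  have hcf : ContinuousOn f (Icc (-a) a) := fun s hs => (hf s hs).continuousWithinAt
  have hcg : ContinuousOn g (Icc (-a) a) := fun s hs => (hg s hs).continuousWithinAt
  obtain ⟨K, hK⟩ := (hF.locallyLipschitzOn (s := f '' Icc (-a) a ∪ g '' Icc (-a) a)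
    ).exists_lipschitzOnWith_of_compact
    ((isCompact_Icc.image_of_continuousOn hcf).union (isCompact_Icc.image_of_continuousOn hcg))
  refine ODE_solution_unique_of_mem_Ioo (v := fun _ => F) (t₀ := 0)
    (s := fun _ => f '' Icc (-a) a ∪ g '' Icc (-a) a) (fun _ _ => hK)
    ⟨by linarith [ht.1, ht.2], by linarith [ht.1, ht.2]⟩ ?_ ?_ h0 ht
  · intro s hs
    have hs' := Ioo_subset_Icc_self hs
    exact ⟨(hf s hs').hasDerivAt (Icc_mem_nhds hs.1 hs.2), Or.inl (mem_image_of_mem f hs')⟩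
  · intro s hs
    have hs' := Ioo_subset_Icc_self hs
    exact ⟨(hg s hs').hasDerivAt (Icc_mem_nhds hs.1 hs.2), Or.inr (mem_image_of_mem g hs')⟩

lemma exists_hasDerivAt_of_bounded {E : Type*} [NormedAddCommGroup E] [NormedSpace ℝ E]
    [ProperSpace E] {F : E → E} (hF : LocallyLipschitz F) {C : ℝ} (hC : ∀ x, ‖F x‖ ≤ C) (x : E) :
    ∃ α : ℝ → E, α 0 = x ∧ ∀ t, HasDerivAt α (F (α t)) t := by
  have hC0 : 0 ≤ C := (norm_nonneg _).trans (hC x)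
  have local_solution : ∀ n : ℕ, ∃ α : ℝ → E, α 0 = x ∧
      ∀ t ∈ Icc (-((n : ℝ) + 1)) (n + 1),
        HasDerivWithinAt α (F (α t)) (Icc (-((n : ℝ) + 1)) (n + 1)) t := by
    intro n
    have hn : (0 : ℝ) ≤ n := n.cast_nonneg
    obtain ⟨K, hK⟩ := (hF.locallyLipschitzOn
      (s := Metric.closedBall x (C * (n + 1)))).exists_lipschitzOnWith_of_compact
      (isCompact_closedBall _ _)
    have hPL : IsPicardLindelof (fun _ => F) (tmin := -((n : ℝ) + 1)) (tmax := n + 1)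
        ⟨0, by constructor <;> linarith⟩ x (⟨C * (n + 1), by positivity⟩ : NNReal) 0
        (⟨C, hC0⟩ : NNReal) K :=
      IsPicardLindelof.of_time_independent (fun y _ => hC y) hK
        (by change C * max ((n : ℝ) + 1 - 0) (0 - -((n : ℝ) + 1)) ≤ C * (n + 1) - 0; simp)
    exact hPL.exists_eq_forall_mem_Icc_hasDerivWithinAt₀
  choose α hα0 hα using local_solution
  have agree : ∀ m n : ℕ, m ≤ n → ∀ t : ℝ, |t| ≤ m → α m t = α n t := by
    intro m n hmn t ht
    have hmn' : (m : ℝ) ≤ n := by exact_mod_cast hmn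
    have hsub : Icc (-((m : ℝ) + 1)) (m + 1) ⊆ Icc (-((n : ℝ) + 1)) (n + 1) :=
      Icc_subset_Icc (by linarith) (by linarith)
    refine eqOn_Ioo_of_hasDerivWithinAt_Icc hF (hα m)
      (fun s hs => (hα n s (hsub hs)).mono hsub) ((hα0 m).trans (hα0 n).symm) ?_
    have := abs_le.1 ht
    constructor <;> linarith
  refine ⟨fun t => α ⌈|t|⌉₊ t, by simp [hα0], fun t => ?_⟩
  set N := ⌈|t|⌉₊ + 1 with hN
  have htN : |t| < N := by
    have := Nat.le_ceil |t|
    push_cast [hN]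
    linarith
  have hev : ∀ s : ℝ, |s| < N → α ⌈|s|⌉₊ s = α N s := fun s hs =>
    agree _ _ (Nat.ceil_le.2 hs.le) s (Nat.le_ceil _)
  have hd : HasDerivAt (α N) (F (α N t)) t := by
    have := abs_lt.1 htN
    exact (hα N t ⟨by linarith, by linarith⟩).hasDerivAt
      (Icc_mem_nhds (by linarith) (by linarith))
  simp only [hev t htN]
  refine hd.congr_of_eventuallyEq ?_
  filter_upwards [(isOpen_lt continuous_abs continuous_const).mem_nhds htN] with s hs
  exact hev s hs

/-! ### Scalar lemmas -/

lemma nonneg_of_deriv_nonneg_of_neg {f f' : ℝ → ℝ} (h0 : 0 ≤ f 0)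
    (hf : ∀ t, 0 ≤ t → HasDerivAt f (f' t) t) (h : ∀ t, 0 < t → f t < 0 → 0 ≤ f' t)
    {t : ℝ} (ht : 0 ≤ t) : 0 ≤ f t := by
  by_contra! hneg
  have hcont : ContinuousOn f (Icc 0 t) := fun s hs => (hf s hs.1).continuousAt.continuousWithinAt
  obtain ⟨s, ⟨hs, hfs⟩, hmax⟩ := (isCompact_Icc.of_isClosed_subset
    (hcont.preimage_isClosed_of_isClosed isClosed_Icc isClosed_Ici)
    inter_subset_left).exists_isGreatest
    ⟨0, ⟨le_rfl, ht⟩, h0⟩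
  have hneg' : ∀ r ∈ Ioo s t, f r < 0 := fun r hr => by
    by_contra! hr0
    exact hr.1.not_ge (hmax ⟨⟨hs.1.trans hr.1.le, hr.2.le⟩, hr0⟩)
  have hmono : MonotoneOn f (Icc s t) := by
    refine monotoneOn_of_deriv_nonneg (convex_Icc s t)
      (hcont.mono (Icc_subset_Icc_left hs.1)) (fun r hr => ?_) (fun r hr => ?_)
    all_goals rw [interior_Icc] at hr
    · exact (hf r (hs.1.trans hr.1.le)).differentiableAt.differentiableWithinAt
    · rw [(hf r (hs.1.trans hr.1.le)).deriv]
      exact h r (hs.1.trans_lt hr.1) (hneg' r hr)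
  have := hmono (left_mem_Icc.2 hs.2) (right_mem_Icc.2 hs.2) hs.2
  exact (lt_of_le_of_lt (le_trans hfs this) hneg).false

lemma exists_time_change {θ ρ : ℝ → ℝ} (h0 : θ 0 = 0) (hθ : ∀ s, HasDerivAt θ (ρ s) s)
    (hρ : ∀ s, 0 < ρ s) {B : ℝ} (hB : ∀ s, θ s ≤ B) :
    ∃ (τ : ℝ) (S : ℝ → ℝ), 0 < τ ∧ S 0 = 0 ∧
      (∀ t ∈ Ico 0 τ, 0 ≤ S t ∧ HasDerivAt S (ρ (S t))⁻¹ t) ∧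
      Tendsto S (𝓝[<] τ) atTop := by
  have hmono : StrictMono θ := strictMono_of_hasDerivAt_pos hθ hρ
  have hcont : Continuous θ := continuous_iff_continuousAt.2 fun s => (hθ s).continuousAt
  have hbdd : BddAbove (range θ) := ⟨B, by rintro _ ⟨s, rfl⟩; exact hB s⟩
  have hlt : ∀ s, θ s < ⨆ r, θ r := fun s =>
    (hmono (lt_add_one s)).trans_le (le_ciSup hbdd _)
  have hsurj : ∀ s t, θ s ≤ t → t < ⨆ r, θ r → ∃ r, s ≤ r ∧ θ r = t := by
    intro s t hst ht
    obtain ⟨r, hr⟩ := exists_lt_of_lt_ciSup ht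
    have hsr : s ≤ r := hmono.le_iff_le.1 (hst.trans hr.le)
    obtain ⟨q, hq, rfl⟩ := intermediate_value_Icc hsr hcont.continuousOn ⟨hst, hr.le⟩
    exact ⟨q, hq.1, rfl⟩
  have hinv : ∀ s, Function.invFun θ (θ s) = s := Function.leftInverse_invFun hmono.injective
  refine ⟨⨆ r, θ r, Function.invFun θ, h0 ▸ hlt 0, ?_, ?_, ?_⟩
  · simpa [h0] using hinv 0
  · rintro t ⟨ht0, ht⟩
    obtain ⟨s, hs, rfl⟩ := hsurj 0 t (h0.trans_le ht0) ht
    refine ⟨(hinv s).symm ▸ hs, ?_⟩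
    have himage : ∀ᶠ y in 𝓝 (θ s), y ∈ range θ := by
      filter_upwards [Ioo_mem_nhds (hmono (sub_one_lt s)) (hlt s)] with y hy
      obtain ⟨r, -, hr⟩ := hsurj _ y hy.1.le hy.2
      exact ⟨r, hr⟩
    have hS : StrictMonoOn (Function.invFun θ) (range θ) := by
      rintro _ ⟨a, rfl⟩ _ ⟨b, rfl⟩ hab
      rw [hinv, hinv]
      exact hmono.lt_iff_lt.1 hab
    refine HasDerivAt.of_local_left_inverse ?_ (hθ _) (hρ _).ne' ?_
    · refine hS.continuousAt_of_image_mem_nhds himage ?_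
      convert univ_mem
      exact eq_univ_of_forall fun r => ⟨θ r, mem_range_self r, hinv r⟩
    · filter_upwards [himage]
      rintro _ ⟨a, rfl⟩
      rw [hinv]
  · refine tendsto_atTop.2 fun R => ?_
    filter_upwards [Ioo_mem_nhdsLT (hlt R)] with t ht
    obtain ⟨r, hr, rfl⟩ := hsurj R t ht.1.le ht.2
    rwa [hinv]

lemma tendsto_norm_atTop_of_bounded_clock {E : Type*} [NormedAddCommGroup E] [NormedSpace ℝ E]
    [ProperSpace E] {V : ℝ → E} {V' : ℝ → E} {C : ℝ} {θ : ℝ → ℝ} {ρ : E → ℝ}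
    (hV : ∀ s, 0 ≤ s → HasDerivAt V (V' s) s) (hV' : ∀ s, 0 ≤ s → ‖V' s‖ ≤ C)
    (hρ : Continuous ρ) (hρ0 : ∀ x, 0 < ρ x)
    (hθ : ∀ s, 0 ≤ s → HasDerivAt θ (ρ (V s)) s) {B : ℝ} (hB : ∀ s, 0 ≤ s → θ s ≤ B) :
    Tendsto (fun s => ‖V s‖) atTop atTop := by
  have hmono : MonotoneOn θ (Ici 0) := by
    refine monotoneOn_of_deriv_nonneg (convex_Ici 0)
      (fun s hs => (hθ s hs).continuousAt.continuousWithinAt)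
      (fun s hs => ?_) (fun s hs => ?_)
    all_goals rw [interior_Ici] at hs
    · exact (hθ s (le_of_lt hs)).differentiableAt.differentiableWithinAt
    · rw [(hθ s (le_of_lt hs)).deriv]
      exact (hρ0 _).le
  by_contra hcon
  simp only [tendsto_atTop, not_forall, not_eventually, not_le] at hcon
  obtain ⟨R, hR⟩ := hcon
  have hR0 : 0 < R := by
    obtain ⟨s, hs⟩ := hR.exists
    exact (norm_nonneg _).trans_lt hs
  have hC0 : 0 ≤ C := (norm_nonneg _).trans (hV' 0 le_rfl)
  obtain ⟨y, -, hy⟩ := (isCompact_closedBall (0 : E) (R + C)).exists_isMinOn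
    ⟨0, by simp; linarith⟩ hρ.continuousOn
  have hne : ((θ '' Ici 0)).Nonempty := ⟨θ 0, 0, self_mem_Ici, rfl⟩
  have hbdd : BddAbove (θ '' Ici 0) := ⟨B, by rintro _ ⟨s, hs, rfl⟩; exact hB s hs⟩
  obtain ⟨_, ⟨s₀, hs₀, rfl⟩, hlt⟩ :=
    exists_lt_of_lt_csSup hne (sub_lt_self (sSup (θ '' Ici 0)) (hρ0 y))
  obtain ⟨s, hs, hVs⟩ := (frequently_atTop.1 hR) s₀
  have hs0 : 0 ≤ s := le_trans hs₀ hs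
  have hle : θ (s + 1) ≤ sSup (θ '' Ici 0) := le_csSup hbdd ⟨s + 1, by simp; linarith, rfl⟩
  have hge : θ s₀ ≤ θ s := hmono hs₀ hs0 hs
  have hball : ∀ r ∈ Icc s (s + 1), V r ∈ Metric.closedBall (0 : E) (R + C) := by
    intro r hr
    have := (convex_Icc s (s + 1)).norm_image_sub_le_of_norm_hasDerivWithin_le
      (f := V) (f' := V') (C := C)
      (fun q hq => (hV q (hs0.trans hq.1)).hasDerivWithinAt) (fun q hq => hV' q (hs0.trans hq.1))
      (left_mem_Icc.2 (by linarith)) hr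
    have h1 : ‖r - s‖ ≤ 1 := by
      rw [Real.norm_eq_abs, abs_le]
      constructor <;> linarith [hr.1, hr.2]
    have h2 : ‖V r‖ ≤ ‖V r - V s‖ + ‖V s‖ := norm_le_norm_sub_add _ _
    have h3 : C * ‖r - s‖ ≤ C * 1 := mul_le_mul_of_nonneg_left h1 hC0
    rw [mem_closedBall_zero_iff]
    linarith
  obtain ⟨q, hq, hqeq⟩ := exists_hasDerivAt_eq_slope θ (fun r => ρ (V r)) (lt_add_one s)
    (fun r hr => (hθ r (hs0.trans hr.1)).continuousAt.continuousWithinAt)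
    (fun r hr => hθ r (hs0.trans hr.1.le))
  have hyq : ρ y ≤ ρ (V q) := hy (hball q (Ioo_subset_Icc_self hq))
  have : ρ (V q) = θ (s + 1) - θ s := by simpa using hqeq
  linarith

/-! ### The vector field -/

lemma coordFn_of_lt {d : ℕ} (u : Fin d → ℝ) {n : ℕ} (hn : n < d) : coordFn u n = u ⟨n, hn⟩ :=
  dif_pos hn

lemma coordFn_val {d : ℕ} (u : Fin d → ℝ) (i : Fin d) : coordFn u i = u i :=
  coordFn_of_lt u i.2

lemma coordFn_mono {d : ℕ} {u v : Fin d → ℝ} (huv : u ≤ v) (n : ℕ) :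
    coordFn u n ≤ coordFn v n := by
  unfold coordFn
  split_ifs
  exacts [huv _, le_rfl]

lemma coordFn_smul {d : ℕ} (s : ℝ) (u : Fin d → ℝ) (n : ℕ) :
    coordFn (s • u) n = s * coordFn u n := by
  unfold coordFn
  split_ifs <;> simp

lemma contDiff_coordFn {d : ℕ} (n : ℕ) : ContDiff ℝ 1 fun u : Fin d → ℝ => coordFn u n := by
  unfold coordFn
  split_ifs <;> fun_prop

lemma locallyLipschitz_bField {d : ℕ} {h p : ℝ} (hp : 1 < p) :
    LocallyLipschitz (bField d h p) := by
  have hpow : LocallyLipschitz fun u : Fin d → ℝ => (max (coordFn u (d - 1)) 0) ^ p :=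
    (Real.contDiff_rpow_const_of_le (n := 1) (by simpa using hp.le)).locallyLipschitz.comp
      ((contDiff_coordFn (d - 1)).locallyLipschitz.max_const 0)
  refine locallyLipschitz_pi_of_apply fun i => ?_
  have hsmooth : ContDiff ℝ 1 fun q : (Fin d → ℝ) × ℝ =>
      if (i : ℕ) = 0 then (2 / h ^ 2) * (-coordFn q.1 0 + coordFn q.1 1)
      else if (i : ℕ) = d - 1 then
        (2 / h ^ 2) * (-coordFn q.1 (d - 1) + coordFn q.1 (d - 2)
          + h * (q.2 - coordFn q.1 (d - 1)))
      else (1 / h ^ 2) *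
        (coordFn q.1 ((i : ℕ) + 1) - 2 * coordFn q.1 (i : ℕ) + coordFn q.1 ((i : ℕ) - 1)) := by
    have hc : ∀ n, ContDiff ℝ 1 fun q : (Fin d → ℝ) × ℝ => coordFn q.1 n := fun n =>
      (contDiff_coordFn n).comp contDiff_fst
    split_ifs <;> fun_prop
  have hcomp := hsmooth.locallyLipschitz.comp (LocallyLipschitz.id.prodMk hpow)
  simp only [Function.comp_def, id_eq] at hcomp
  exact hcomp

lemma bField_le_of_le {d : ℕ} {h p : ℝ} {u v : Fin d → ℝ} (huv : u ≤ v) {i : Fin d}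
    (hi : u i = v i) (hh : 0 < h) : bField d h p u i ≤ bField d h p v i := by
  have hc : coordFn u i = coordFn v i := by rw [coordFn_val, coordFn_val, hi]
  unfold bField
  split_ifs with h0 h1
  · rw [h0] at hc
    rw [hc]
    gcongr
    exact coordFn_mono huv _
  · rw [h1] at hc
    rw [hc]
    gcongr
    exact coordFn_mono huv _
  · rw [hc]
    gcongr
    · exact coordFn_mono huv _
    · exact coordFn_mono huv _

lemma bField_zero {d : ℕ} {h p : ℝ} (hp : 1 < p) : bField d h p 0 = 0 := by
  have hc : ∀ n, coordFn (0 : Fin d → ℝ) n = 0 := fun n => by simp [coordFn]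
  funext i
  simp [bField, hc, Real.zero_rpow (by linarith : p ≠ 0)]

/-- The defect of homogeneity of the vector field under a scaling by `s`. -/
lemma bField_smul {d : ℕ} {h p s : ℝ} (hs : 0 ≤ s) (u : Fin d → ℝ) (i : Fin d) :
    bField d h p (s • u) i = s * bField d h p u i +
      if (i : ℕ) = 0 then 0 else if (i : ℕ) = d - 1 then
        (2 / h ^ 2) * (h * ((s ^ p - s) * (max (coordFn u (d - 1)) 0) ^ p)) else 0 := by
  unfold bField
  simp only [coordFn_smul]
  have hmax : max (s * coordFn u (d - 1)) 0 = s * max (coordFn u (d - 1)) 0 := by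
    rw [mul_max_of_nonneg _ _ hs, mul_zero]
  rw [hmax, Real.mul_rpow hs (le_max_right _ _)]
  split_ifs <;> ring

lemma le_bField_smul {d : ℕ} {h p s : ℝ} (hh : 0 < h) (hp : 1 < p) (hs : 1 ≤ s)
    (u : Fin d → ℝ) (i : Fin d) : s * bField d h p u i ≤ bField d h p (s • u) i := by
  rw [bField_smul (by linarith)]
  have : 0 ≤ s ^ p - s := sub_nonneg.2 (Real.self_le_rpow_of_one_le hs hp.le)
  have : 0 ≤ (max (coordFn u (d - 1)) 0) ^ p := Real.rpow_nonneg (le_max_right _ _) _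
  split_ifs
  · simp
  · have : 0 ≤ (2 / h ^ 2) * (h * ((s ^ p - s) * (max (coordFn u (d - 1)) 0) ^ p)) := by
      positivity
    linarith
  · simp

lemma bField_smul_le {d : ℕ} {h p s : ℝ} (hh : 0 < h) (hp : 1 < p) (hs0 : 0 ≤ s) (hs : s ≤ 1)
    (u : Fin d → ℝ) (i : Fin d) : bField d h p (s • u) i ≤ s * bField d h p u i := by
  rw [bField_smul hs0]
  have : 0 ≤ s - s ^ p := sub_nonneg.2 (Real.rpow_le_self_of_le_one hs0 hs hp.le)
  have : 0 ≤ (max (coordFn u (d - 1)) 0) ^ p := Real.rpow_nonneg (le_max_right _ _) _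
  split_ifs
  · simp
  · have : 0 ≤ (2 / h ^ 2) * (h * ((s - s ^ p) * (max (coordFn u (d - 1)) 0) ^ p)) := by
      positivity
    linarith
  · simp

lemma le_bField_last {d : ℕ} {h p : ℝ} (hd : 2 ≤ d) (hh : 0 < h) {u : Fin d → ℝ} (hu : 0 ≤ u) :
    (2 / h ^ 2) * (h * u ⟨d - 1, by omega⟩ ^ p - (1 + h) * u ⟨d - 1, by omega⟩) ≤
      bField d h p u ⟨d - 1, by omega⟩ := by
  unfold bField
  rw [if_neg (by simp; omega), if_pos rfl, coordFn_of_lt u (by omega : d - 1 < d),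
    coordFn_of_lt u (by omega : d - 2 < d),
    max_eq_left (show (0 : ℝ) ≤ u ⟨d - 1, by omega⟩ from hu _)]
  have : 0 ≤ u ⟨d - 2, by omega⟩ := hu _
  gcongr
  linarith

/-- Near `𝟙` there are vectors above it (`σ = 1`) where the field is positive and vectors below it
(`σ = -1`) where the field is negative. -/
lemma exists_bField_sign {d : ℕ} {h p : ℝ} (hd : 2 ≤ d) (hh : 0 < h) (hp : 1 < p) {σ : ℝ}
    (hσ : σ = 1 ∨ σ = -1) {ε : ℝ} (hε0 : 0 < ε) (hε1 : ε < 1) :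
    ∃ z : Fin d → ℝ, (∀ i, 0 < σ * (z i - 1) ∧ σ * (z i - 1) ≤ ε) ∧
      ∀ i, 0 < σ * bField d h p z i := by
  have hσσ : σ * σ = 1 := by rcases hσ with rfl | rfl <;> norm_num
  obtain ⟨k, rfl⟩ := Nat.exists_eq_add_of_le' hd
  set G := σ * ((1 + σ * ε) ^ p - (1 + σ * ε)) with hG
  have hbase : 0 < 1 + σ * ε := by rcases hσ with rfl | rfl <;> linarith
  have hG0 : 0 < G := by
    rcases hσ with rfl | rfl
    · have := Real.self_lt_rpow_of_one_lt (x := 1 + 1 * ε) (by linarith) hp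
      linarith
    · have := Real.rpow_lt_self_of_lt_one (x := 1 + -1 * ε) (by linarith) (by linarith) hp
      linarith
  set D : ℝ := k + 1 with hD
  have hD1 : 1 ≤ D := by simp [hD]
  set m := min ε (h * G) with hm
  have hm0 : 0 < m := lt_min hε0 (by positivity)
  set η := m / (2 * D ^ 2 + 2 * D + 1) with hη
  have hη0 : 0 < η := by positivity
  have hηm : η * (2 * D ^ 2 + 2 * D + 1) = m := by
    rw [hη]
    field_simp
  have hmε : m ≤ ε := min_le_left _ _
  have hmG : m ≤ h * G := min_le_right _ _
  set z : Fin (k + 2) → ℝ := fun i => 1 + σ * (ε - η * (D ^ 2 - (i : ℝ) ^ 2)) with hz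
  have hcoord : ∀ n, n < k + 2 → coordFn z n = 1 + σ * (ε - η * (D ^ 2 - (n : ℝ) ^ 2)) :=
    fun n hn => coordFn_of_lt z hn
  refine ⟨z, fun i => ?_, fun i => ?_⟩
  · have hi : ((i : ℕ) : ℝ) ≤ D := by
      have := i.2
      have : (i : ℕ) ≤ k + 1 := by omega
      simpa [hD] using (by exact_mod_cast this : ((i : ℕ) : ℝ) ≤ (k : ℝ) + 1)
    have hi2 : ((i : ℕ) : ℝ) ^ 2 ≤ D ^ 2 := by gcongr
    have hval : σ * (z i - 1) = ε - η * (D ^ 2 - ((i : ℕ) : ℝ) ^ 2) := by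
      rw [hz]
      linear_combination (ε - η * (D ^ 2 - ((i : ℕ) : ℝ) ^ 2)) * hσσ
    rw [hval]
    constructor
    · nlinarith [mul_nonneg hη0.le (sq_nonneg ((i : ℕ) : ℝ)), mul_nonneg hη0.le (sq_nonneg D),
        mul_nonneg hη0.le (zero_le_one.trans hD1)]
    · nlinarith
  · unfold bField
    split_ifs with h0 h1
    · rw [hcoord 0 (by omega), hcoord 1 (by omega)]
      have : σ * (2 / h ^ 2 * (-(1 + σ * (ε - η * (D ^ 2 - ((0 : ℕ) : ℝ) ^ 2))) +
          (1 + σ * (ε - η * (D ^ 2 - ((1 : ℕ) : ℝ) ^ 2))))) = 2 / h ^ 2 * η := by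
        push_cast
        linear_combination (2 / h ^ 2 * η) * hσσ
      rw [this]
      positivity
    · have e1 : k + 2 - 1 = k + 1 := rfl
      have e2 : k + 2 - 2 = k := rfl
      have hlast : coordFn z (k + 1) = 1 + σ * ε := by
        rw [hcoord _ (by omega), hD]
        push_cast
        ring
      rw [e1, e2, hlast, hcoord k (by omega), max_eq_left hbase.le]
      have hk : (k : ℝ) = D - 1 := by rw [hD]; ring
      have : σ * (2 / h ^ 2 * (-(1 + σ * ε) + (1 + σ * (ε - η * (D ^ 2 - (k : ℝ) ^ 2))) +
          h * ((1 + σ * ε) ^ p - (1 + σ * ε)))) = 2 / h ^ 2 * (h * G - η * (2 * D - 1)) := by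
        rw [hG, hk]
        linear_combination (-(2 / h ^ 2) * η * (2 * D - 1)) * hσσ
      rw [this]
      have : 0 < h * G - η * (2 * D - 1) := by
        nlinarith [mul_nonneg hη0.le (sq_nonneg D)]
      positivity
    · obtain ⟨j, hj⟩ := Nat.exists_eq_succ_of_ne_zero h0
      have hi := i.2
      rw [hj, Nat.succ_eq_add_one, hcoord _ (by omega), hcoord _ (by omega), hcoord _ (by omega)]
      simp only [Nat.add_sub_cancel]
      push_cast
      have : σ * (1 / h ^ 2 * ((1 + σ * (ε - η * (D ^ 2 - ((j : ℝ) + 1 + 1) ^ 2))) -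
          2 * (1 + σ * (ε - η * (D ^ 2 - ((j : ℝ) + 1) ^ 2))) +
          (1 + σ * (ε - η * (D ^ 2 - (j : ℝ) ^ 2))))) = 2 / h ^ 2 * η := by
        linear_combination (2 / h ^ 2 * η) * hσσ
      rw [this]
      positivity

lemma euclNorm_le_of_abs_le {d : ℕ} {u : Fin d → ℝ} {r : ℝ} (hr : ∀ i, |u i| ≤ r) :
    euclNorm u ≤ d * r := by
  unfold euclNorm
  calc √(∑ i, u i ^ 2) ≤ ∑ i, |u i| := by
        refine Real.sqrt_le_iff.2 ⟨Finset.sum_nonneg fun i _ => abs_nonneg _, ?_⟩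
        calc ∑ i, u i ^ 2 = ∑ i, |u i| ^ 2 := by simp
          _ ≤ (∑ i, |u i|) ^ 2 := Finset.sum_sq_le_sq_sum_of_nonneg fun i _ => abs_nonneg _
    _ ≤ ∑ _i : Fin d, r := Finset.sum_le_sum fun i _ => hr i
    _ = d * r := by simp

lemma norm_le_euclNorm {d : ℕ} (u : Fin d → ℝ) : ‖u‖ ≤ euclNorm u := by
  refine (pi_norm_le_iff_of_nonneg (Real.sqrt_nonneg _)).2 fun i => ?_
  refine Real.le_sqrt_of_sq_le ?_
  rw [Real.norm_eq_abs, sq_abs]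
  exact Finset.single_le_sum (f := fun i => u i ^ 2) (fun j _ => sq_nonneg _) (Finset.mem_univ i)

/-! ### Decay below and blow-up above the equilibrium -/

lemma exists_pos_mul_le {ι : Type*} [Finite ι] (w : ι → ℝ) {f : ι → ℝ} (hf : ∀ i, 0 < f i) :
    ∃ κ > 0, ∀ i, κ * w i ≤ f i := by
  have hev : ∀ i, ∀ᶠ κ in 𝓝[>] (0 : ℝ), κ * w i < f i := fun i => by
    have : Tendsto (fun κ : ℝ => κ * w i) (𝓝[>] 0) (𝓝 (0 * w i)) :=
      (tendsto_id.mono_left nhdsWithin_le_nhds).mul_const _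
    exact this.eventually_lt_const (by simpa using hf i)
  obtain ⟨κ, hκ, hκ0⟩ := ((eventually_all.2 hev).and self_mem_nhdsWithin).exists
  exact ⟨κ, hκ0, fun i => (hκ i).le⟩

/-- Truncation from above by a positive vector decaying exponentially, and from below by `0`. -/
noncomputable def clampBelow {d : ℕ} (κ : ℝ) (w : Fin d → ℝ) (q : (Fin d → ℝ) × ℝ) : Fin d → ℝ :=
  fun i => max 0 (min (q.1 i) (Real.exp (-κ * |q.2|) * w i))

lemma locallyLipschitz_clampBelow {d : ℕ} (κ : ℝ) (w : Fin d → ℝ) :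
    LocallyLipschitz (clampBelow κ w) := by
  refine locallyLipschitz_pi_of_apply fun i => ?_
  have h1 : LocallyLipschitz fun q : (Fin d → ℝ) × ℝ => q.1 i :=
    ContDiff.locallyLipschitz (𝕂 := ℝ) (by fun_prop)
  have hnorm : LocallyLipschitz fun q : (Fin d → ℝ) × ℝ => |q.2| :=
    (lipschitzWith_one_norm (E := ℝ)).locallyLipschitz.comp
      LipschitzWith.prod_snd.locallyLipschitz
  have hexp : LocallyLipschitz fun x : ℝ => Real.exp (-κ * x) * w i :=
    ContDiff.locallyLipschitz (𝕂 := ℝ) (by fun_prop)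
  exact (h1.min (hexp.comp hnorm)).const_max 0

lemma globalTo_zero_of_bField_neg {d : ℕ} {h p : ℝ} (hh : 0 < h) (hp : 1 < p) {w : Fin d → ℝ}
    (hw : ∀ i, 0 < w i) (hb : ∀ i, bField d h p w i < 0) : GlobalTo d h p w 0 := by
  obtain ⟨κ, hκ0, hκ⟩ := exists_pos_mul_le w (f := fun i => -bField d h p w i)
    fun i => neg_pos.2 (hb i)
  have hbL := locallyLipschitz_bField (d := d) (h := h) hp
  have hmem : ∀ q, clampBelow κ w q ∈ Icc 0 w := fun q => by
    refine ⟨fun i => le_max_left _ _, fun i => max_le (hw i).le ((min_le_right _ _).trans ?_)⟩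
    have : Real.exp (-κ * |q.2|) ≤ 1 := by
      rw [Real.exp_le_one_iff]
      nlinarith [abs_nonneg q.2]
    exact mul_le_of_le_one_left (hw i).le this
  obtain ⟨C, hC⟩ := isCompact_Icc.exists_bound_of_continuousOn
    (hbL.continuous.continuousOn (s := Icc 0 w))
  have hF : LocallyLipschitz fun q : (Fin d → ℝ) × ℝ =>
      (bField d h p (clampBelow κ w q), (1 : ℝ)) :=
    (hbL.comp (locallyLipschitz_clampBelow κ w)).prodMk (LocallyLipschitz.const 1)
  obtain ⟨α, hα0, hα⟩ := exists_hasDerivAt_of_bounded hF (C := max C 1) (fun q => by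
    rw [Prod.norm_def]
    exact max_le_max (hC _ (hmem q)) (by simp)) (w, 0)
  have hθ : ∀ t, (α t).2 = t := by
    have hd : ∀ t, HasDerivAt (fun t => (α t).2 - t) 0 t := fun t => by
      have hsnd : HasDerivAt (fun t => (α t).2) 1 t := (hα t).snd
      exact (hsnd.sub (hasDerivAt_id t)).congr_deriv (sub_self 1)
    intro t
    have := is_const_of_deriv_eq_zero (fun t => (hd t).differentiableAt)
      (fun t => (hd t).deriv) t 0
    simp only [hα0] at this
    linarith
  have hU : ∀ t i, HasDerivAt (fun t => (α t).1 i) (bField d h p (clampBelow κ w (α t)) i) t :=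
    fun t i => hasDerivAt_pi.1 (hα t).fst i
  have hlower : ∀ t, 0 ≤ t → ∀ i, 0 ≤ (α t).1 i := fun t ht i => by
    refine nonneg_of_deriv_nonneg_of_neg (f := fun t => (α t).1 i) (by simp [hα0, (hw i).le])
      (fun t _ => hU t i) (fun s _ hneg => ?_) ht
    have : bField d h p 0 i ≤ bField d h p (clampBelow κ w (α s)) i :=
      bField_le_of_le (hmem _).1
        (max_eq_left ((min_le_left _ _).trans hneg.le)).symm hh
    simpa [bField_zero hp] using this
  have hupper : ∀ t, 0 ≤ t → ∀ i, (α t).1 i ≤ Real.exp (-κ * t) * w i := fun t ht i => by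
    have hψ : ∀ s, HasDerivAt (fun s => Real.exp (-κ * s) * w i - (α s).1 i)
        (Real.exp (-κ * s) * (-κ) * w i - bField d h p (clampBelow κ w (α s)) i) s := fun s => by
      have hexp : HasDerivAt (fun s => Real.exp (-κ * s)) (Real.exp (-κ * s) * (-κ)) s := by
        simpa using ((hasDerivAt_id s).const_mul (-κ)).exp
      exact (hexp.mul_const (w i)).sub (hU s i)
    refine sub_nonneg.1 (nonneg_of_deriv_nonneg_of_neg
      (f := fun s => Real.exp (-κ * s) * w i - (α s).1 i) (by simp [hα0])
      (fun t _ => hψ t) (fun s hs hneg => ?_) ht)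
    have habs : Real.exp (-κ * |(α s).2|) = Real.exp (-κ * s) := by rw [hθ, abs_of_pos hs]
    have hpos : ∀ j, 0 ≤ Real.exp (-κ * s) * w j := fun j =>
      mul_nonneg (Real.exp_pos _).le (hw j).le
    have h1 : bField d h p (clampBelow κ w (α s)) i ≤
        bField d h p (Real.exp (-κ * s) • w) i := by
      refine bField_le_of_le (fun j => ?_) ?_ hh
      · simp only [clampBelow, habs, Pi.smul_apply, smul_eq_mul]
        exact max_le (hpos j) (min_le_right _ _)
      · simp only [clampBelow, habs, Pi.smul_apply, smul_eq_mul]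
        rw [min_eq_right (sub_neg.1 hneg).le, max_eq_right (hpos i)]
    have h2 := bField_smul_le hh hp (Real.exp_pos (-κ * s)).le
      (Real.exp_le_one_iff.2 (by nlinarith)) w i
    have h3 := mul_le_mul_of_nonneg_left (hκ i) (Real.exp_pos (-κ * s)).le
    linarith
  have hclamp : ∀ t, 0 ≤ t → clampBelow κ w (α t) = (α t).1 := fun t ht => by
    funext i
    simp only [clampBelow, hθ, abs_of_nonneg ht]
    rw [min_eq_left (hupper t ht i), max_eq_right (hlower t ht i)]
  refine ⟨fun t => (α t).1, by simp [hα0], fun t ht => ?_, ?_⟩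
  · have hfst : HasDerivAt (fun t => (α t).1) (bField d h p (clampBelow κ w (α t))) t :=
      (hα t).fst
    rw [hclamp t ht] at hfst
    exact hfst.hasDerivWithinAt
  · refine tendsto_pi_nhds.2 fun i => ?_
    have hexp : Tendsto (fun t : ℝ => Real.exp (-κ * t) * w i) atTop (𝓝 0) := by
      have h1 : Tendsto (fun t : ℝ => -κ * t) atTop atBot :=
        tendsto_id.const_mul_atTop_of_neg (neg_lt_zero.2 hκ0)
      simpa using (Real.tendsto_exp_atBot.comp h1).mul_const (w i)
    refine squeeze_zero' ?_ ?_ hexp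
    · filter_upwards [eventually_ge_atTop 0] with t ht using hlower t ht i
    · filter_upwards [eventually_ge_atTop 0] with t ht using hupper t ht i

/-- Truncation from below by an exponentially growing vector. -/
noncomputable def clampAbove {d : ℕ} (κ : ℝ) (v : Fin d → ℝ) (q : (Fin d → ℝ) × ℝ) : Fin d → ℝ :=
  fun i => max (q.1 i) (Real.exp (κ * q.2) * v i)

lemma locallyLipschitz_clampAbove {d : ℕ} (κ : ℝ) (v : Fin d → ℝ) :
    LocallyLipschitz (clampAbove κ v) := by
  refine locallyLipschitz_pi_of_apply fun i => ?_
  have h1 : LocallyLipschitz fun q : (Fin d → ℝ) × ℝ => q.1 i :=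
    ContDiff.locallyLipschitz (𝕂 := ℝ) (by fun_prop)
  have h2 : LocallyLipschitz fun q : (Fin d → ℝ) × ℝ => Real.exp (κ * q.2) * v i :=
    ContDiff.locallyLipschitz (𝕂 := ℝ) (by fun_prop)
  exact h1.max h2

/-- The factor slowing a velocity `x` down to speed at most `1`. -/
noncomputable def slowdown {d : ℕ} (x : Fin d → ℝ) : ℝ := (1 + ∑ j, x j ^ 2)⁻¹

lemma one_add_sum_sq_pos {d : ℕ} (x : Fin d → ℝ) : 0 < 1 + ∑ j, x j ^ 2 := by
  have : 0 ≤ ∑ j, x j ^ 2 := Finset.sum_nonneg fun j _ => sq_nonneg _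
  linarith

lemma slowdown_pos {d : ℕ} (x : Fin d → ℝ) : 0 < slowdown x := inv_pos.2 (one_add_sum_sq_pos x)

lemma contDiff_slowdown {d : ℕ} : ContDiff ℝ 1 (slowdown (d := d)) := by
  unfold slowdown
  exact ContDiff.inv (by fun_prop) fun x => (one_add_sum_sq_pos x).ne'

lemma slowdown_le_one {d : ℕ} (x : Fin d → ℝ) : slowdown x ≤ 1 := by
  refine inv_le_one_of_one_le₀ ?_
  have : 0 ≤ ∑ j, x j ^ 2 := Finset.sum_nonneg fun j _ => sq_nonneg _
  linarith

lemma norm_slowdown_smul_le {d : ℕ} (x : Fin d → ℝ) : ‖slowdown x • x‖ ≤ 1 := by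
  refine (pi_norm_le_iff_of_nonneg zero_le_one).2 fun i => ?_
  rw [Pi.smul_apply, norm_smul, Real.norm_of_nonneg (slowdown_pos x).le, slowdown,
    inv_mul_le_one₀ (one_add_sum_sq_pos x), Real.norm_eq_abs]
  have := Finset.single_le_sum (f := fun i => x i ^ 2) (fun j _ => sq_nonneg _)
    (Finset.mem_univ i)
  nlinarith [sq_abs (x i), sq_nonneg (|x i| - 1)]

lemma clock_le_of_superlinear {p A B κ : ℝ} (hp : 1 < p) (hA : 0 < A) (hκ : 0 < κ)
    {x x' θ θ' : ℝ → ℝ}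
    (hx : ∀ s, 0 ≤ s → HasDerivAt x (x' s) s) (hθ : ∀ s, 0 ≤ s → HasDerivAt θ (θ' s) s)
    (hθ' : ∀ s, 0 ≤ s → 0 ≤ θ' s) (hθ0 : θ 0 = 0)
    (hgrow : ∀ s, 0 ≤ s → Real.exp (κ * θ s) ≤ x s)
    (hdiff : ∀ s, 0 ≤ s → (A * x s ^ p - B * x s) * θ' s ≤ x' s) :
    ∃ M, ∀ s, 0 ≤ s → θ s ≤ M := by
  have hlim : Tendsto (fun T : ℝ => A / 2 * Real.exp (κ * (p - 1) * T)) atTop atTop :=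
    (Real.tendsto_exp_atTop.comp
      (tendsto_id.const_mul_atTop (mul_pos hκ (sub_pos.2 hp)))).const_mul_atTop (half_pos hA)
  obtain ⟨T, hT, hT0⟩ := ((hlim.eventually_ge_atTop B).and (eventually_ge_atTop 0)).exists
  set L := 2 / (A * (p - 1)) with hL
  have hp1 : 0 < p - 1 := sub_pos.2 hp
  have hL0 : 0 < L := by positivity
  have hmono : MonotoneOn θ (Ici 0) := by
    refine monotoneOn_of_deriv_nonneg (convex_Ici 0)
      (fun s hs => (hθ s hs).continuousAt.continuousWithinAt)
      (fun s hs => ?_) (fun s hs => ?_)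
    all_goals rw [interior_Ici] at hs
    · exact (hθ s (le_of_lt hs)).differentiableAt.differentiableWithinAt
    · rw [(hθ s (le_of_lt hs)).deriv]
      exact hθ' s (le_of_lt hs)
  have hx1 : ∀ s, 0 ≤ s → 1 ≤ x s := fun s hs => by
    refine le_trans (Real.one_le_exp ?_) (hgrow s hs)
    exact mul_nonneg hκ.le (hθ0 ▸ hmono self_mem_Ici hs hs)
  have hy1 : ∀ s, 0 ≤ s → x s ^ (1 - p) ≤ 1 := fun s hs =>
    Real.rpow_le_one_of_one_le_of_nonpos (hx1 s hs) (by linarith)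
  have hbound : ∀ s, 0 ≤ s → 0 ≤ T + L * (1 - x s ^ (1 - p)) - θ s := fun s hs => by
    refine nonneg_of_deriv_nonneg_of_neg (f := fun s => T + L * (1 - x s ^ (1 - p)) - θ s)
      (f' := fun s => L * (-(x' s * (1 - p) * x s ^ (1 - p - 1))) - θ' s) ?_ ?_ ?_ hs
    · have := hy1 0 le_rfl
      rw [hθ0]
      nlinarith
    · intro r hr
      have hne : x r ≠ 0 := (zero_lt_one.trans_le (hx1 r hr)).ne'
      exact (((((hx r hr).rpow_const (Or.inl hne)).const_sub 1).const_mul L).const_add T).sub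
        (hθ r hr)
    · intro r hr hneg
      have hr0 := hr.le
      have hxpos : 0 < x r := zero_lt_one.trans_le (hx1 r hr0)
      have hTθ : T ≤ θ r := by nlinarith [hy1 r hr0]
      have hB : B ≤ A / 2 * x r ^ (p - 1) := by
        refine hT.trans ?_
        gcongr
        calc Real.exp (κ * (p - 1) * T) ≤ Real.exp (κ * θ r * (p - 1)) := by
              refine Real.exp_le_exp.2 ?_
              nlinarith [mul_le_mul_of_nonneg_left hTθ (mul_pos hκ hp1).le]
          _ = Real.exp (κ * θ r) ^ (p - 1) := Real.exp_mul _ _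
          _ ≤ x r ^ (p - 1) := Real.rpow_le_rpow (Real.exp_pos _).le (hgrow r hr0) hp1.le
      have hxp : x r ^ p = x r ^ (p - 1) * x r := by
        rw [← Real.rpow_add_one hxpos.ne']
        ring_nf
      have hx' : A / 2 * x r ^ p * θ' r ≤ x' r := by
        refine le_trans ?_ (hdiff r hr0)
        refine mul_le_mul_of_nonneg_right ?_ (hθ' r hr0)
        have := mul_le_mul_of_nonneg_right hB hxpos.le
        rw [hxp]
        linarith
      have hinv : x r ^ p * x r ^ (1 - p - 1) = 1 := by
        rw [← Real.rpow_add hxpos]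
        simp
      have hpow : 0 < x r ^ (1 - p - 1) := Real.rpow_pos_of_pos hxpos _
      have hkey : A / 2 * θ' r ≤ x' r * x r ^ (1 - p - 1) := by
        calc A / 2 * θ' r = A / 2 * x r ^ p * θ' r * x r ^ (1 - p - 1) := by
              linear_combination (-(A / 2 * θ' r)) * hinv
          _ ≤ _ := mul_le_mul_of_nonneg_right hx' hpow.le
      have hLA : L * (p - 1) * (A / 2) = 1 := by
        rw [hL]
        field_simp
      have := mul_le_mul_of_nonneg_left hkey (mul_pos hL0 hp1).le
      linear_combination this - θ' r * hLA
  refine ⟨T + L, fun s hs => ?_⟩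
  have h1 := hbound s hs
  have h2 : 0 ≤ x s ^ (1 - p) := Real.rpow_nonneg (zero_le_one.trans (hx1 s hs)) _
  nlinarith

lemma blowsUp_of_bField_pos {d : ℕ} {h p : ℝ} (hd : 2 ≤ d) (hh : 0 < h) (hp : 1 < p)
    {v : Fin d → ℝ} (hv : ∀ i, 1 ≤ v i) (hb : ∀ i, 0 < bField d h p v i) :
    BlowsUp d h p v := by
  obtain ⟨κ, hκ0, hκ⟩ := exists_pos_mul_le v hb
  have hbL := locallyLipschitz_bField (d := d) (h := h) hp
  set β : (Fin d → ℝ) × ℝ → Fin d → ℝ := fun q => bField d h p (clampAbove κ v q) with hβ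
  have hβL : LocallyLipschitz β := hbL.comp (locallyLipschitz_clampAbove κ v)
  have hΦ : ContDiff ℝ 1 fun x : Fin d → ℝ => (slowdown x • x, slowdown x) :=
    (contDiff_slowdown.smul contDiff_id).prodMk contDiff_slowdown
  have hF : LocallyLipschitz fun q => (slowdown (β q) • β q, slowdown (β q)) :=
    hΦ.locallyLipschitz.comp hβL
  obtain ⟨α, hα0, hα⟩ := exists_hasDerivAt_of_bounded hF (C := 1) (fun q => by
    rw [Prod.norm_def]
    refine max_le (norm_slowdown_smul_le _) ?_
    rw [Real.norm_of_nonneg (slowdown_pos _).le]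
    exact slowdown_le_one _) (v, 0)
  have hθ : ∀ s, HasDerivAt (fun s => (α s).2) (slowdown (β (α s))) s := fun s => (hα s).snd
  have hU : ∀ s i, HasDerivAt (fun s => (α s).1 i) (slowdown (β (α s)) * β (α s) i) s :=
    fun s i => hasDerivAt_pi.1 (hα s).fst i
  have hθmono : StrictMono fun s => (α s).2 :=
    strictMono_of_hasDerivAt_pos hθ fun s => slowdown_pos _
  have hθ0 : ∀ s, 0 ≤ s → 0 ≤ (α s).2 := fun s hs => by
    have := hθmono.monotone hs
    simpa [hα0] using this
  have hlower : ∀ s, 0 ≤ s → ∀ i, Real.exp (κ * (α s).2) * v i ≤ (α s).1 i := fun s hs i => by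
    have hψ : ∀ s, HasDerivAt (fun s => (α s).1 i - Real.exp (κ * (α s).2) * v i)
        (slowdown (β (α s)) * β (α s) i -
          Real.exp (κ * (α s).2) * (κ * slowdown (β (α s))) * v i) s := fun s =>
      (hU s i).sub ((((hθ s).const_mul κ).exp).mul_const (v i))
    refine sub_nonneg.1 (nonneg_of_deriv_nonneg_of_neg
      (f := fun s => (α s).1 i - Real.exp (κ * (α s).2) * v i) (by simp [hα0])
      (fun t _ => hψ t) (fun r hr hneg => ?_) hs)
    have h1 : bField d h p (Real.exp (κ * (α r).2) • v) i ≤ β (α r) i :=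
      bField_le_of_le (fun j => le_max_right _ _) (max_eq_right (sub_neg.1 hneg).le).symm hh
    have h2 := le_bField_smul hh hp
      (Real.one_le_exp (mul_nonneg hκ0.le (hθ0 r hr.le))) v i
    have h3 := mul_le_mul_of_nonneg_left (hκ i) (Real.exp_pos (κ * (α r).2)).le
    have h4 := mul_le_mul_of_nonneg_left (h3.trans (h2.trans h1)) (slowdown_pos (β (α r))).le
    linarith
  have hclamp : ∀ s, 0 ≤ s → β (α s) = bField d h p (α s).1 := fun s hs => by
    have : clampAbove κ v (α s) = (α s).1 := funext fun i => max_eq_left (hlower s hs i)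
    simp only [hβ, this]
  have hgrow : ∀ s, 0 ≤ s → ∀ i, Real.exp (κ * (α s).2) ≤ (α s).1 i := fun s hs i =>
    le_trans (le_mul_of_one_le_right (Real.exp_pos _).le (hv i)) (hlower s hs i)
  obtain ⟨M, hM⟩ := clock_le_of_superlinear (A := 2 / h ^ 2 * h) (B := 2 / h ^ 2 * (1 + h))
    (x := fun s => (α s).1 ⟨d - 1, by omega⟩) (θ := fun s => (α s).2) hp (by positivity) hκ0
    (fun s _ => hU s _) (fun s _ => hθ s) (fun s _ => (slowdown_pos _).le) (by simp [hα0])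
    (fun s hs => hgrow s hs _) (fun s hs => by
      have := le_bField_last (p := p) hd hh (u := (α s).1)
        fun i => (Real.exp_pos _).le.trans (hgrow s hs i)
      rw [← hclamp s hs] at this
      have := mul_le_mul_of_nonneg_left this (slowdown_pos (β (α s))).le
      linarith)
  obtain ⟨τ, S, hτ, hS0, hS, hS_lim⟩ := exists_time_change (θ := fun s => (α s).2)
    (by simp [hα0]) hθ (fun s => slowdown_pos _) (B := M) fun s => by
      rcases le_total 0 s with hs | hs
      · exact hM s hs
      · exact (hθmono.monotone hs).trans (hM 0 le_rfl)
  have hnorm : Tendsto (fun s => ‖(α s).1‖) atTop atTop :=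
    tendsto_norm_atTop_of_bounded_clock (θ := fun s => (α s).2)
      (ρ := fun u => slowdown (bField d h p u)) (C := 1) (fun s _ => (hα s).fst)
      (fun s _ => norm_slowdown_smul_le _) (contDiff_slowdown.continuous.comp hbL.continuous)
      (fun u => slowdown_pos _) (fun s hs => hclamp s hs ▸ hθ s) hM
  refine ⟨τ, fun t => (α (S t)).1, hτ, by simp [hS0, hα0], fun t ht => ?_, ?_⟩
  · obtain ⟨hSt, hdS⟩ := hS t ht
    have hd := HasDerivAt.scomp t (hα (S t)).fst hdS
    rw [smul_smul, inv_mul_cancel₀ (slowdown_pos _).ne', one_smul, hclamp _ hSt] at hd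
    exact hd.hasDerivWithinAt
  · exact tendsto_atTop_mono (fun t => norm_le_euclNorm _) (hnorm.comp hS_lim)

/-- the equilibrium `𝟙` is unstable, with initial data arbitrarily close to it
leading both to finite-time blow-up and to global solutions converging to the origin. -/
theorem stmt9 (d : ℕ) (hd : 2 ≤ d) (h p : ℝ) (hh : 0 < h) (hp : 1 < p)
    (δ : ℝ) (hδ : 0 < δ) :
    ∃ v w : Fin d → ℝ,
      euclNorm (v - fun _ => 1) < δ ∧ euclNorm (w - fun _ => 1) < δ ∧
      BlowsUp d h p v ∧ GlobalTo d h p w 0 := by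
  set ε := min (1 / 2) (δ / (2 * d)) with hε
  have hd0 : (0 : ℝ) < d := by exact_mod_cast (by omega : 0 < d)
  have hε0 : 0 < ε := by positivity
  have hε1 : ε < 1 := (min_le_left _ _).trans_lt (by norm_num)
  have hdε : d * ε < δ := by
    calc d * ε ≤ d * (δ / (2 * d)) := by gcongr; exact min_le_right _ _
      _ = δ / 2 := by field_simp
      _ < δ := half_lt_self hδ
  obtain ⟨v, hv, hbv⟩ := exists_bField_sign hd hh hp (Or.inl rfl) hε0 hε1
  obtain ⟨w, hw, hbw⟩ := exists_bField_sign hd hh hp (Or.inr rfl) hε0 hε1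
  refine ⟨v, w, (euclNorm_le_of_abs_le fun i => ?_).trans_lt hdε,
    (euclNorm_le_of_abs_le fun i => ?_).trans_lt hdε,
    blowsUp_of_bField_pos hd hh hp (fun i => by linarith [(hv i).1]) (fun i => by linarith [hbv i]),
    globalTo_zero_of_bField_neg hh hp (fun i => by linarith [(hw i).2])
      (fun i => by linarith [hbw i])⟩
  · exact abs_le.2 ⟨by simp only [Pi.sub_apply]; linarith [(hv i).1],
      by simp only [Pi.sub_apply]; linarith [(hv i).2]⟩
  · exact abs_le.2 ⟨by simp only [Pi.sub_apply]; linarith [(hw i).2],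
      by simp only [Pi.sub_apply]; linarith [(hw i).1]⟩
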